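/- There exist universal constants c₁, c₂ > 0 with the following property. Let n ≥ 1 be an integer and F = F₁ ⊗ … ⊗ F_n a product probability measure on [0,∞)ⁿ where each marginal F_i is atomless, has a density, and satisfies the monotone hazard rate condition. Let ε' ∈ (0,1/2), fix a strict total order ≻ on {1,…,n}, and suppose β̂ > 0 satisfies both P_{v∼F}[max_i v_i ≥ β̂/2] ≥ 1 − 1/√e − ε' and E_{v∼F}[(max_i v_i)·1{max_i v_i ≥ 2β̂·ln(1/ε')}] ≤ 36·β̂·ε'·ln(1/ε'). Then for every integer t ≥ c₂·(1/ε' + ln(ln(1/ε'))/ln(1+ε')), there exists a t-level single-item auction A with tie-breaking order ≻ such that E_{v∼F}[min(Rev_A(v), 2β̂·ln(1/ε'))] ≥ (1 − c₁·ε'·ln(1/ε'))·OPT(F). -/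

import Mathlib

open MeasureTheory
open scoped ENNReal

attribute [local instance] Classical.propDecidable

/-- A `t`-level single-item auction for `n` bidders: nondecreasing thresholds
`thr i 0 ≤ thr i 1 ≤ … ≤ thr i (t-1)` for each bidder `i`. -/
structure TLevel (n t : ℕ) where
  thr : Fin n → Fin t → ℝ
  mono : ∀ i, Monotone (thr i)

namespace TLevel

/-- The level of a bid `b` for bidder `i`: the largest index `τ` with `thr i τ ≤ b`,
or `-1` if no threshold is met (computed as the number of met thresholds minus one,
which coincides with the largest met index since the thresholds are nondecreasing). -/
noncomputable def level {n t : ℕ} (A : TLevel n t) (i : Fin n) (b : ℝ) : ℤ :=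
  ((Finset.univ.filter fun τ : Fin t => A.thr i τ ≤ b).card : ℤ) - 1

/-- Bidder `i` wins: her level is ≥ 0 and she beats every other bidder, either by a
strictly higher level or by the tie-breaking order `succ` at equal levels. -/
def wins {n t : ℕ} (A : TLevel n t) (succ : Fin n → Fin n → Prop)
    (v : Fin n → ℝ) (i : Fin n) : Prop :=
  0 ≤ A.level i (v i) ∧ ∀ j : Fin n, j ≠ i →
    (A.level j (v j) < A.level i (v i) ∨
      (A.level j (v j) = A.level i (v i) ∧ succ i j))

/-- The winner's payment: the infimum over bids at which she would still win. -/
noncomputable def payment {n t : ℕ} (A : TLevel n t) (succ : Fin n → Fin n → Prop)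
    (v : Fin n → ℝ) (i : Fin n) : ℝ :=
  sInf {b : ℝ | A.wins succ (Function.update v i b) i}

/-- The revenue of the auction on profile `v`: the winner (if any) pays her
critical bid; losers pay nothing. -/
noncomputable def Rev {n t : ℕ} (A : TLevel n t) (succ : Fin n → Fin n → Prop)
    (v : Fin n → ℝ) : ℝ :=
  ∑ i : Fin n, if A.wins succ v i then A.payment succ v i else 0

end TLevel

/-- A deterministic DSIC-IR single-item auction for `n` bidders with valuations in `V`:
a measurable 0/1 allocation awarding at most one item, and measurable nonnegative payments
bounded by value times allocation, such that truthful bidding is a dominant strategy. -/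
structure SIAuction (n : ℕ) (V : Set ℝ) where
  alloc : (Fin n → ℝ) → Fin n → ℝ
  pay : (Fin n → ℝ) → Fin n → ℝ
  alloc_meas : ∀ i, Measurable fun v => alloc v i
  pay_meas : ∀ i, Measurable fun v => pay v i
  alloc01 : ∀ v i, alloc v i = 0 ∨ alloc v i = 1
  feas : ∀ v, (∑ i, alloc v i) ≤ 1
  pay_nonneg : ∀ v i, 0 ≤ pay v i
  pay_le : ∀ v, (∀ j, v j ∈ V) → ∀ i, pay v i ≤ v i * alloc v i
  dsic : ∀ v : Fin n → ℝ, (∀ j, v j ∈ V) → ∀ (i : Fin n) (b : ℝ), b ∈ V →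
    v i * alloc (Function.update v i b) i - pay (Function.update v i b) i ≤
      v i * alloc v i - pay v i

/-- `OPT n V F`: the supremum of expected revenue over all DSIC-IR single-item
auctions with valuations in `V`, for bid distribution `F`. -/
noncomputable def OPT (n : ℕ) (V : Set ℝ) (F : Measure (Fin n → ℝ)) : ℝ≥0∞ :=
  ⨆ A : SIAuction n V, ∫⁻ v, ∑ i, ENNReal.ofReal (A.pay v i) ∂F

/-- An atomless probability measure on `[0, ∞)` with density `f`, finite mean and
nondecreasing hazard rate. -/
structure IsMHRDensity (μ : Measure ℝ) (f : ℝ → ℝ) : Prop where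
  prob : IsProbabilityMeasure μ
  atomless : ∀ x : ℝ, μ {x} = 0
  measurable : Measurable f
  nonneg : ∀ x, 0 ≤ f x
  eq_withDensity : μ = volume.withDensity fun x => ENNReal.ofReal (f x)
  Iio_zero : μ (Set.Iio 0) = 0
  hazard_mono : ∀ x y : ℝ, x ≤ y → (μ (Set.Iic y)).toReal < 1 →
    f x / (1 - (μ (Set.Iic x)).toReal) ≤ f y / (1 - (μ (Set.Iic y)).toReal)
  mean_ne_top : ∫⁻ x, ENNReal.ofReal x ∂μ ≠ ⊤

/-- The virtual value function of a distribution with density `f`. -/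
noncomputable def virtualValue (μ : Measure ℝ) (f : ℝ → ℝ) (x : ℝ) : ℝ :=
  x - (1 - (μ (Set.Iic x)).toReal) / f x

/-- The values at which the virtual value is defined and at least `g`, together with the values
beyond the support. -/
def virtualUpperSet (μ : Measure ℝ) (f : ℝ → ℝ) (g : ℝ) : Set ℝ :=
  {x | (μ (Set.Iic x)).toReal < 1 → 0 < f x ∧ g ≤ virtualValue μ f x}

/-- The smallest value with virtual value at least `g`. -/
noncomputable def virtualThreshold (μ : Measure ℝ) (f : ℝ → ℝ) (g : ℝ) : ℝ :=
  sInf (virtualUpperSet μ f g)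

theorem lintegral_Ici_eq_add_tail (μ : Measure ℝ) {p : ℝ} (hp : 0 ≤ p) :
    ∫⁻ x in Set.Ici p, ENNReal.ofReal x ∂μ =
      ENNReal.ofReal p * μ (Set.Ici p) + ∫⁻ t in Set.Ioi p, μ (Set.Ioi t) := by
  have h1 : ∫⁻ x in Set.Ici p, ENNReal.ofReal x ∂μ =
      ∫⁻ x in Set.Ici p, (ENNReal.ofReal p + ENNReal.ofReal (x - p)) ∂μ := by
    refine setLIntegral_congr_fun measurableSet_Ici fun x hx => ?_
    simp only [Set.mem_Ici] at hx
    rw [← ENNReal.ofReal_add hp (by linarith)]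
    congr 1
    ring
  have h2 : ∫⁻ x in Set.Ici p, ENNReal.ofReal (x - p) ∂μ =
      ∫⁻ t in Set.Ioi 0, μ (Set.Ioi (t + p)) := by
    rw [lintegral_eq_lintegral_meas_lt]
    · refine setLIntegral_congr_fun measurableSet_Ioi fun t ht => ?_
      simp only [Set.mem_Ioi] at ht
      rw [Measure.restrict_apply (measurableSet_lt measurable_const (by fun_prop))]
      congr 1
      ext x
      simp only [Set.mem_inter_iff, Set.mem_ofPred_eq, Set.mem_Ici, Set.mem_Ioi]
      constructor
      · rintro ⟨h, -⟩
        linarith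
      · intro h
        constructor <;> linarith
    · filter_upwards [ae_restrict_mem measurableSet_Ici] with x hx
      simp only [Set.mem_Ici] at hx
      simpa using hx
    · fun_prop
  have h3 : ∫⁻ t in Set.Ioi 0, μ (Set.Ioi (t + p)) = ∫⁻ t in Set.Ioi p, μ (Set.Ioi t) := by
    rw [← lintegral_indicator measurableSet_Ioi, ← lintegral_indicator measurableSet_Ioi,
      ← lintegral_add_right_eq_self ((Set.Ioi p).indicator fun t => μ (Set.Ioi t)) p]
    refine lintegral_congr fun t => ?_
    simp [Set.indicator]
  rw [h1, lintegral_add_left measurable_const, h2, h3]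
  simp

namespace IsMHRDensity

variable {μ : Measure ℝ} {f : ℝ → ℝ}

theorem measure_Ioi (h : IsMHRDensity μ f) (x : ℝ) :
    μ (Set.Ioi x) = ENNReal.ofReal (1 - (μ (Set.Iic x)).toReal) := by
  have := h.prob
  have h1 := prob_compl_eq_one_sub (μ := μ) (measurableSet_Iic (a := x))
  rw [Set.compl_Iic] at h1
  rw [h1, ENNReal.ofReal_sub _ ENNReal.toReal_nonneg, ENNReal.ofReal_one,
    ENNReal.ofReal_toReal (measure_ne_top _ _)]

theorem cdf_le_one (h : IsMHRDensity μ f) (x : ℝ) : (μ (Set.Iic x)).toReal ≤ 1 := by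
  have := h.prob
  exact ENNReal.toReal_le_of_le_ofReal zero_le_one (by simpa using prob_le_one)

theorem cdf_mono (h : IsMHRDensity μ f) {x y : ℝ} (hxy : x ≤ y) :
    (μ (Set.Iic x)).toReal ≤ (μ (Set.Iic y)).toReal := by
  have := h.prob
  exact ENNReal.toReal_mono (measure_ne_top _ _) (measure_mono (Set.Iic_subset_Iic.2 hxy))

theorem cdf_of_neg (h : IsMHRDensity μ f) {x : ℝ} (hx : x < 0) : (μ (Set.Iic x)).toReal = 0 := by
  have : μ (Set.Iic x) = 0 :=
    measure_mono_null (fun y hy => lt_of_le_of_lt hy hx) h.Iio_zero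
  simp [this]

theorem measurable_cdf (h : IsMHRDensity μ f) :
    Measurable fun x => (μ (Set.Iic x)).toReal :=
  Monotone.measurable fun _ _ hxy => h.cdf_mono hxy

theorem inverse_hazard_nonneg (h : IsMHRDensity μ f) (x : ℝ) :
    0 ≤ (1 - (μ (Set.Iic x)).toReal) / f x :=
  div_nonneg (sub_nonneg.2 (h.cdf_le_one x)) (h.nonneg x)

theorem virtualValue_le (h : IsMHRDensity μ f) (x : ℝ) : virtualValue μ f x ≤ x :=
  sub_le_self _ (h.inverse_hazard_nonneg x)

theorem measurable_inverse_hazard (h : IsMHRDensity μ f) :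
    Measurable fun x => (1 - (μ (Set.Iic x)).toReal) / f x :=
  (measurable_const.sub h.measurable_cdf).div h.measurable

theorem measurable_virtualValue (h : IsMHRDensity μ f) : Measurable (virtualValue μ f) :=
  measurable_id.sub h.measurable_inverse_hazard

theorem ae_nonneg (h : IsMHRDensity μ f) : ∀ᵐ x ∂μ, 0 ≤ x := by
  rw [ae_iff]
  simp only [not_le]
  exact h.Iio_zero

theorem ae_pos_density (h : IsMHRDensity μ f) : ∀ᵐ x ∂μ, 0 < f x := by
  rw [h.eq_withDensity, ae_withDensity_iff h.measurable.ennreal_ofReal]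
  exact Filter.Eventually.of_forall fun x hx => by simpa using hx

theorem ae_cdf_lt_one (h : IsMHRDensity μ f) : ∀ᵐ x ∂μ, (μ (Set.Iic x)).toReal < 1 := by
  have := h.prob
  rw [ae_iff]
  simp only [not_lt]
  set U : Set ℝ := {x | 1 ≤ (μ (Set.Iic x)).toReal} with hU
  rcases U.eq_empty_or_nonempty with hE | hN
  · simp [hE]
  have hbdd : BddBelow U := by
    refine ⟨0, fun x hx => ?_⟩
    by_contra! hlt
    have h0 := h.cdf_of_neg hlt
    simp only [hU, Set.mem_ofPred_eq] at hx
    linarith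
  have hIoi : μ (Set.Ioi (sInf U)) = 0 := by
    obtain ⟨u, -, hu, hlim⟩ := exists_seq_strictAnti_tendsto (sInf U)
    have hsub : Set.Ioi (sInf U) ⊆ ⋃ n, Set.Ioi (u n) := by
      intro x hx
      obtain ⟨n, hn⟩ := (hlim.eventually (gt_mem_nhds hx)).exists
      exact Set.mem_iUnion.2 ⟨n, hn⟩
    refine measure_mono_null hsub (measure_iUnion_null fun n => ?_)
    obtain ⟨y, hy, hyu⟩ := exists_lt_of_csInf_lt hN (hu n)
    rw [h.measure_Ioi, ENNReal.ofReal_eq_zero]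
    have h1 := h.cdf_mono hyu.le
    simp only [hU, Set.mem_ofPred_eq] at hy
    linarith
  refine measure_mono_null (t := {sInf U} ∪ Set.Ioi (sInf U)) (fun x hx => ?_)
    (measure_union_null (h.atomless _) hIoi)
  rcases (csInf_le hbdd hx).eq_or_lt with he | hl
  · exact Or.inl he.symm
  · exact Or.inr hl

theorem hazard_pos_and_virtualValue_mono (h : IsMHRDensity μ f) {x y : ℝ} (hxy : x ≤ y)
    (hy : (μ (Set.Iic y)).toReal < 1) (hx : 0 < f x) :
    0 < f y ∧ virtualValue μ f x ≤ virtualValue μ f y := by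
  have hx1 : 0 < 1 - (μ (Set.Iic x)).toReal := by linarith [h.cdf_mono hxy]
  have hy1 : 0 < 1 - (μ (Set.Iic y)).toReal := by linarith
  have hm := h.hazard_mono x y hxy hy
  have hpx : 0 < f x / (1 - (μ (Set.Iic x)).toReal) := div_pos hx hx1
  have hpy := hpx.trans_le hm
  have hfy : 0 < f y := by
    by_contra! hle
    exact absurd hpy (not_lt.2 (div_nonpos_of_nonpos_of_nonneg hle hy1.le))
  refine ⟨hfy, ?_⟩
  have := inv_anti₀ hpx hm
  rw [inv_div, inv_div] at this
  simp only [virtualValue]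
  linarith

theorem isUpperSet_virtualUpperSet (h : IsMHRDensity μ f) (g : ℝ) :
    IsUpperSet (virtualUpperSet μ f g) := by
  intro x y hxy hx hy
  obtain ⟨h1, h2⟩ := hx ((h.cdf_mono hxy).trans_lt hy)
  obtain ⟨h3, h4⟩ := h.hazard_pos_and_virtualValue_mono hxy hy h1
  exact ⟨h3, h2.trans h4⟩

theorem nonneg_of_mem_virtualUpperSet (h : IsMHRDensity μ f) {g x : ℝ} (hg : 0 ≤ g)
    (hx : x ∈ virtualUpperSet μ f g) : 0 ≤ x := by
  by_contra! hlt
  have h1 := (hx (by rw [h.cdf_of_neg hlt]; exact one_pos)).2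
  linarith [h.virtualValue_le x]

theorem virtualUpperSet_nonempty (h : IsMHRDensity μ f) (g : ℝ) :
    (virtualUpperSet μ f g).Nonempty := by
  have := h.prob
  by_cases hall : ∀ x, (μ (Set.Iic x)).toReal < 1
  · obtain ⟨x₀, hx₀⟩ := h.ae_pos_density.exists
    set y := max x₀ (g + (x₀ - virtualValue μ f x₀)) with hy
    refine ⟨y, fun hlt => ?_⟩
    have hx1 : 0 < 1 - (μ (Set.Iic x₀)).toReal := by linarith [hall x₀]
    have hy1 : 0 < 1 - (μ (Set.Iic y)).toReal := by linarith
    have hxy : x₀ ≤ y := le_max_left _ _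
    refine ⟨(h.hazard_pos_and_virtualValue_mono hxy hlt hx₀).1, ?_⟩
    have hm := inv_anti₀ (div_pos hx₀ hx1) (h.hazard_mono x₀ y hxy hlt)
    rw [inv_div, inv_div] at hm
    have h2 : g + (x₀ - virtualValue μ f x₀) ≤ y := le_max_right _ _
    simp only [virtualValue] at h2 ⊢
    linarith
  · push Not at hall
    obtain ⟨x, hx⟩ := hall
    exact ⟨x, fun hlt => absurd hlt (not_lt.2 hx)⟩

theorem bddBelow_virtualUpperSet (h : IsMHRDensity μ f) {g : ℝ} (hg : 0 ≤ g) :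
    BddBelow (virtualUpperSet μ f g) :=
  ⟨0, fun _ hx => h.nonneg_of_mem_virtualUpperSet hg hx⟩

theorem virtualThreshold_nonneg (h : IsMHRDensity μ f) {g : ℝ} (hg : 0 ≤ g) :
    0 ≤ virtualThreshold μ f g :=
  le_csInf (h.virtualUpperSet_nonempty g) fun _ hx => h.nonneg_of_mem_virtualUpperSet hg hx

theorem virtualThreshold_mono (h : IsMHRDensity μ f) {g g' : ℝ} (hg : 0 ≤ g) (hgg : g ≤ g') :
    virtualThreshold μ f g ≤ virtualThreshold μ f g' :=
  csInf_le_csInf (h.bddBelow_virtualUpperSet hg) (h.virtualUpperSet_nonempty g')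
    fun _ hx hlt => ⟨(hx hlt).1, hgg.trans (hx hlt).2⟩

theorem mem_virtualUpperSet_of_threshold_lt (h : IsMHRDensity μ f) {g x : ℝ}
    (hx : virtualThreshold μ f g < x) : x ∈ virtualUpperSet μ f g := by
  obtain ⟨y, hy, hyx⟩ := exists_lt_of_csInf_lt (h.virtualUpperSet_nonempty g) hx
  exact h.isUpperSet_virtualUpperSet g hyx.le hy

theorem ae_threshold_le_iff (h : IsMHRDensity μ f) {g : ℝ} (hg : 0 ≤ g) :
    ∀ᵐ x ∂μ, virtualThreshold μ f g ≤ x ↔ g ≤ virtualValue μ f x := by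
  have hne : ∀ᵐ x ∂μ, x ≠ virtualThreshold μ f g := by
    rw [ae_iff]
    simpa using h.atomless _
  filter_upwards [hne, h.ae_cdf_lt_one, h.ae_pos_density] with x h1 h2 h3
  constructor
  · intro hle
    exact (h.mem_virtualUpperSet_of_threshold_lt (lt_of_le_of_ne hle h1.symm) h2).2
  · intro hgx
    exact csInf_le (h.bddBelow_virtualUpperSet hg) fun _ => ⟨h3, hgx⟩

theorem setLIntegral_inverse_hazard (h : IsMHRDensity μ f) (p : ℝ) :
    ∫⁻ x in Set.Ici p, ENNReal.ofReal ((1 - (μ (Set.Iic x)).toReal) / f x) ∂μ =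
      ∫⁻ x in Set.Ioi p, ENNReal.ofReal (f x * ((1 - (μ (Set.Iic x)).toReal) / f x)) := by
  have : NullSingletonClass μ := ⟨h.atomless⟩
  rw [← restrict_Ioi_eq_restrict_Ici]
  set G : ℝ → ENNReal := fun x => ENNReal.ofReal ((1 - (μ (Set.Iic x)).toReal) / f x) with hG
  have hGm : Measurable G := h.measurable_inverse_hazard.ennreal_ofReal
  have h1 : μ.restrict (Set.Ioi p) =
      (volume.restrict (Set.Ioi p)).withDensity fun x => ENNReal.ofReal (f x) := by
    conv_lhs => rw [h.eq_withDensity]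
    exact restrict_withDensity measurableSet_Ioi _
  rw [h1, lintegral_withDensity_eq_lintegral_mul _ h.measurable.ennreal_ofReal hGm]
  refine lintegral_congr fun x => ?_
  simp only [Pi.mul_apply, hG]
  rw [ENNReal.ofReal_mul (h.nonneg x)]

theorem setLIntegral_inverse_hazard_le (h : IsMHRDensity μ f) (p : ℝ) :
    ∫⁻ x in Set.Ici p, ENNReal.ofReal ((1 - (μ (Set.Iic x)).toReal) / f x) ∂μ ≤
      ∫⁻ x in Set.Ioi p, μ (Set.Ioi x) := by
  rw [h.setLIntegral_inverse_hazard p]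
  refine lintegral_mono fun x => ?_
  simp only
  rw [h.measure_Ioi]
  refine ENNReal.ofReal_le_ofReal ?_
  rcases (h.nonneg x).eq_or_lt with h0 | h0
  · rw [← h0]
    simpa using h.cdf_le_one x
  · rw [mul_div_cancel₀ _ h0.ne']

theorem le_setLIntegral_inverse_hazard (h : IsMHRDensity μ f) (g : ℝ) :
    ∫⁻ x in Set.Ioi (virtualThreshold μ f g), μ (Set.Ioi x) ≤
      ∫⁻ x in Set.Ici (virtualThreshold μ f g),
        ENNReal.ofReal ((1 - (μ (Set.Iic x)).toReal) / f x) ∂μ := by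
  rw [h.setLIntegral_inverse_hazard]
  refine setLIntegral_mono' measurableSet_Ioi fun x hx => ?_
  rw [h.measure_Ioi]
  by_cases hlt : (μ (Set.Iic x)).toReal < 1
  · have h0 := (h.mem_virtualUpperSet_of_threshold_lt hx hlt).1
    rw [mul_div_cancel₀ _ h0.ne']
  · rw [ENNReal.ofReal_eq_zero.2 (by linarith)]
    exact zero_le

theorem integrable_id (h : IsMHRDensity μ f) : Integrable (fun x : ℝ => x) μ := by
  refine ⟨by fun_prop, ?_⟩
  rw [hasFiniteIntegral_iff_norm]
  refine lt_of_le_of_lt (le_of_eq ?_) h.mean_ne_top.lt_top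
  refine lintegral_congr_ae ?_
  filter_upwards [h.ae_nonneg] with x hx
  rw [Real.norm_of_nonneg hx]

theorem integrable_inverse_hazard (h : IsMHRDensity μ f) :
    Integrable (fun x => (1 - (μ (Set.Iic x)).toReal) / f x) μ := by
  refine ⟨h.measurable_inverse_hazard.aestronglyMeasurable, ?_⟩
  rw [hasFiniteIntegral_iff_ofReal (Filter.Eventually.of_forall h.inverse_hazard_nonneg)]
  have hr : μ.restrict (Set.Ici 0) = μ :=
    Measure.restrict_eq_self_of_ae_mem h.ae_nonneg
  have h1 := h.setLIntegral_inverse_hazard_le 0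
  have h2 := lintegral_Ici_eq_add_tail μ (le_refl (0 : ℝ))
  rw [hr] at h1 h2
  simp only [ENNReal.ofReal_zero, zero_mul, zero_add] at h2
  rw [← h2] at h1
  exact h1.trans_lt h.mean_ne_top.lt_top

theorem integrable_virtualValue (h : IsMHRDensity μ f) : Integrable (virtualValue μ f) μ :=
  h.integrable_id.sub h.integrable_inverse_hazard

theorem setIntegral_virtualValue (h : IsMHRDensity μ f) {p : ℝ} (hp : 0 ≤ p) :
    ∫ x in Set.Ici p, virtualValue μ f x ∂μ =
      (∫⁻ x in Set.Ici p, ENNReal.ofReal x ∂μ).toReal -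
      (∫⁻ x in Set.Ici p, ENNReal.ofReal ((1 - (μ (Set.Iic x)).toReal) / f x) ∂μ).toReal := by
  simp only [virtualValue]
  rw [integral_sub h.integrable_id.integrableOn h.integrable_inverse_hazard.integrableOn,
    integral_eq_lintegral_of_nonneg_ae _ h.integrable_id.integrableOn.aestronglyMeasurable,
    integral_eq_lintegral_of_nonneg_ae
      (Filter.Eventually.of_forall h.inverse_hazard_nonneg)
      h.integrable_inverse_hazard.integrableOn.aestronglyMeasurable]
  filter_upwards [ae_restrict_mem measurableSet_Ici] with x hx
  exact hp.trans hx

theorem setLIntegral_Ici_ne_top (h : IsMHRDensity μ f) (p : ℝ) :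
    ∫⁻ x in Set.Ici p, ENNReal.ofReal x ∂μ ≠ ⊤ :=
  ne_top_of_le_ne_top h.mean_ne_top (setLIntegral_le_lintegral _ _)

/-- The revenue of any posted price is at most the expected virtual value of the buyers. -/
theorem posted_price_le (h : IsMHRDensity μ f) {p : ℝ} (hp : 0 ≤ p) :
    p * μ.real (Set.Ici p) ≤ ∫ x in Set.Ici p, virtualValue μ f x ∂μ := by
  have := h.prob
  rw [h.setIntegral_virtualValue hp]
  have h1 := h.setLIntegral_Ici_ne_top p
  have h2 := lintegral_Ici_eq_add_tail μ hp
  have h3 := h.setLIntegral_inverse_hazard_le p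
  rw [h2] at h1
  rw [h2, ENNReal.toReal_add (ENNReal.add_ne_top.1 h1).1 (ENNReal.add_ne_top.1 h1).2,
    ENNReal.toReal_mul, ENNReal.toReal_ofReal hp, measureReal_def]
  have := ENNReal.toReal_mono (ENNReal.add_ne_top.1 h1).2 h3
  linarith

/-- At a virtual value threshold the posted-price revenue attains the expected virtual value. -/
theorem le_posted_price (h : IsMHRDensity μ f) {g : ℝ} (hg : 0 ≤ g) :
    ∫ x in Set.Ici (virtualThreshold μ f g), virtualValue μ f x ∂μ ≤
      virtualThreshold μ f g * μ.real (Set.Ici (virtualThreshold μ f g)) := by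
  have := h.prob
  have hp := h.virtualThreshold_nonneg hg
  rw [h.setIntegral_virtualValue hp]
  have h1 := h.setLIntegral_Ici_ne_top (virtualThreshold μ f g)
  have h2 := lintegral_Ici_eq_add_tail μ hp
  have h3 := h.le_setLIntegral_inverse_hazard g
  have h4 := h.setLIntegral_inverse_hazard_le (virtualThreshold μ f g)
  rw [h2] at h1
  rw [h2, ENNReal.toReal_add (ENNReal.add_ne_top.1 h1).1 (ENNReal.add_ne_top.1 h1).2,
    ENNReal.toReal_mul, ENNReal.toReal_ofReal hp, measureReal_def]
  have := ENNReal.toReal_mono (ne_top_of_le_ne_top (ENNReal.add_ne_top.1 h1).2 h4) h3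
  linarith

end IsMHRDensity
namespace TLevel

variable {n t : ℕ} (A : TLevel n t) {succ : Fin n → Fin n → Prop}

theorem le_level_iff (i : Fin n) (k : Fin t) (b : ℝ) :
    ((k : ℕ) : ℤ) ≤ A.level i b ↔ A.thr i k ≤ b := by
  unfold level
  constructor
  · intro hk
    by_contra! hlt
    have hsub : (Finset.univ.filter fun τ : Fin t => A.thr i τ ≤ b) ⊆ Finset.Iio k := by
      intro τ hτ
      simp only [Finset.mem_filter, Finset.mem_univ, true_and] at hτ
      rw [Finset.mem_Iio]
      by_contra! hle
      linarith [A.mono i hle]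
    have := Finset.card_le_card hsub
    rw [Fin.card_Iio] at this
    omega
  · intro hle
    have hsub : Finset.Iic k ⊆ Finset.univ.filter fun τ : Fin t => A.thr i τ ≤ b := by
      intro τ hτ
      simp only [Finset.mem_filter, Finset.mem_univ, true_and]
      exact (A.mono i (Finset.mem_Iic.1 hτ)).trans hle
    have := Finset.card_le_card hsub
    rw [Fin.card_Iic] at this
    omega

theorem level_lt (i : Fin n) (b : ℝ) : A.level i b < t := by
  have := Finset.card_le_univ (Finset.univ.filter fun τ : Fin t => A.thr i τ ≤ b)
  rw [Fintype.card_fin] at this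
  unfold level
  omega

theorem level_mono (i : Fin n) : Monotone (A.level i) := by
  intro b b' hb
  unfold level
  have : (Finset.univ.filter fun τ : Fin t => A.thr i τ ≤ b).card ≤
      (Finset.univ.filter fun τ : Fin t => A.thr i τ ≤ b').card :=
    Finset.card_le_card (Finset.monotone_filter_right _ fun τ _ h => le_trans h hb)
  omega

theorem wins_update_iff (v : Fin n → ℝ) (i : Fin n) (b : ℝ) :
    A.wins succ (Function.update v i b) i ↔ 0 ≤ A.level i b ∧ ∀ j : Fin n, j ≠ i →
      (A.level j (v j) < A.level i b ∨ (A.level j (v j) = A.level i b ∧ succ i j)) := by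
  unfold wins
  rw [Function.update_self]
  refine and_congr_right fun _ => forall_congr' fun j => forall_congr' fun hj => ?_
  rw [Function.update_of_ne hj]

/-- The set of winning bids is empty or a half-line starting at a threshold. -/
theorem winning_bids (succ : Fin n → Fin n → Prop) (v : Fin n → ℝ) (i : Fin n) :
    {b : ℝ | A.wins succ (Function.update v i b) i} = ∅ ∨
      ∃ k : Fin t, {b : ℝ | A.wins succ (Function.update v i b) i} = Set.Ici (A.thr i k) := by
  set Q : ℤ → Prop := fun m => 0 ≤ m ∧ ∀ j : Fin n, j ≠ i →
      (A.level j (v j) < m ∨ (A.level j (v j) = m ∧ succ i j)) with hQ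
  have hQmono : ∀ m m', m ≤ m' → Q m → Q m' := by
    intro m m' hm h
    refine ⟨h.1.trans hm, fun j hj => ?_⟩
    rcases hm.eq_or_lt with rfl | hlt
    · exact h.2 j hj
    · rcases h.2 j hj with h1 | h1
      · exact Or.inl (h1.trans hlt)
      · exact Or.inl (h1.1.trans_lt hlt)
  have hw : ∀ b, A.wins succ (Function.update v i b) i ↔ Q (A.level i b) :=
    fun b => A.wins_update_iff v i b
  simp only [hw]
  by_cases hex : ∃ m : ℕ, Q m
  · by_cases hlt : Nat.find hex < t
    · right
      refine ⟨⟨Nat.find hex, hlt⟩, ?_⟩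
      ext b
      simp only [Set.mem_ofPred_eq, Set.mem_Ici]
      rw [← A.le_level_iff i ⟨Nat.find hex, hlt⟩ b]
      constructor
      · intro h
        obtain ⟨m, hm⟩ := Int.eq_ofNat_of_zero_le h.1
        have : Nat.find hex ≤ m := Nat.find_min' hex (by rw [← hm]; exact h)
        simp only
        omega
      · intro h
        exact hQmono _ _ h (Nat.find_spec hex)
    · left
      ext b
      simp only [Set.mem_ofPred_eq, Set.mem_empty_iff_false, iff_false]
      intro h
      obtain ⟨m, hm⟩ := Int.eq_ofNat_of_zero_le h.1
      have h1 : Nat.find hex ≤ m := Nat.find_min' hex (by rw [← hm]; exact h)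
      have h2 := A.level_lt i b
      omega
  · left
    ext b
    simp only [Set.mem_ofPred_eq, Set.mem_empty_iff_false, iff_false]
    intro h
    obtain ⟨m, hm⟩ := Int.eq_ofNat_of_zero_le h.1
    exact hex ⟨m, by rw [← hm]; exact h⟩

theorem measurable_level (i : Fin n) : Measurable (A.level i) :=
  (A.level_mono i).measurable

theorem measurable_levels : Measurable fun (v : Fin n → ℝ) j => A.level j (v j) :=
  measurable_pi_lambda _ fun j => (A.measurable_level j).comp (measurable_pi_apply j)

theorem measurableSet_wins (succ : Fin n → Fin n → Prop) (i : Fin n) :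
    MeasurableSet {v : Fin n → ℝ | A.wins succ v i} :=
  A.measurable_levels (Set.to_countable {L : Fin n → ℤ | 0 ≤ L i ∧ ∀ j : Fin n, j ≠ i →
    (L j < L i ∨ (L j = L i ∧ succ i j))}).measurableSet

theorem measurable_payment (succ : Fin n → Fin n → Prop) (i : Fin n) :
    Measurable fun v => A.payment succ v i := by
  have h := (measurable_of_countable fun L : Fin n → ℤ =>
    sInf {b : ℝ | 0 ≤ A.level i b ∧ ∀ j : Fin n, j ≠ i →
      (L j < A.level i b ∨ (L j = A.level i b ∧ succ i j))}).comp A.measurable_levels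
  simp only [payment, wins_update_iff]
  exact h

theorem measurable_bidder_revenue (succ : Fin n → Fin n → Prop) (i : Fin n) :
    Measurable fun v => if A.wins succ v i then A.payment succ v i else 0 :=
  Measurable.ite (A.measurableSet_wins succ i) (A.measurable_payment succ i) measurable_const

theorem wins_unique (hs : IsStrictTotalOrder (Fin n) succ) {v : Fin n → ℝ} {i j : Fin n}
    (hi : A.wins succ v i) (hj : A.wins succ v j) : i = j := by
  by_contra hne
  rcases hi.2 j (Ne.symm hne) with h1 | ⟨h1, h1'⟩ <;> rcases hj.2 i hne with h2 | ⟨h2, h2'⟩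
  · omega
  · omega
  · omega
  · exact asymm_of succ h1' h2'

theorem exists_wins (hs : IsStrictTotalOrder (Fin n) succ) {v : Fin n → ℝ} {i : Fin n}
    (hi : 0 ≤ A.level i (v i)) :
    ∃ w, A.wins succ v w ∧ ∀ j, A.level j (v j) ≤ A.level w (v w) := by
  have hne : (Finset.univ : Finset (Fin n)).Nonempty := ⟨i, Finset.mem_univ i⟩
  obtain ⟨m, -, hm⟩ := Finset.exists_max_image Finset.univ (fun j => A.level j (v j)) hne
  have hwf : WellFounded succ := Finite.wellFounded_of_trans_of_irrefl succ
  obtain ⟨w, hw, hmin⟩ := hwf.has_min {j | A.level j (v j) = A.level m (v m)} ⟨m, rfl⟩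
  simp only [Set.mem_ofPred_eq] at hw hmin
  refine ⟨w, ⟨?_, fun j hj => ?_⟩, fun j => ?_⟩
  · rw [hw]
    exact hi.trans (hm i (Finset.mem_univ i))
  · rcases (hm j (Finset.mem_univ j)).lt_or_eq with h | h
    · exact Or.inl (by rw [hw]; exact h)
    · refine Or.inr ⟨by rw [hw]; exact h, ?_⟩
      rcases trichotomous_of succ w j with h1 | h1 | h1
      · exact h1
      · exact absurd h1.symm hj
      · exact absurd h1 (hmin j h)
  · rw [hw]
    exact hm j (Finset.mem_univ j)

theorem payment_mem_Icc (hA : ∀ i k, 0 ≤ A.thr i k) {v : Fin n → ℝ} {i : Fin n}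
    (hw : A.wins succ v i) : A.payment succ v i ∈ Set.Icc 0 (v i) := by
  have hmem : v i ∈ {b : ℝ | A.wins succ (Function.update v i b) i} := by
    simpa using hw
  unfold payment
  rcases A.winning_bids succ v i with h | ⟨k, h⟩
  · rw [h] at hmem
    exact absurd hmem (Set.notMem_empty _)
  · rw [h] at hmem ⊢
    rw [csInf_Ici]
    exact ⟨hA i k, hmem⟩

theorem payment_update (v : Fin n → ℝ) (i : Fin n) (b : ℝ) :
    A.payment succ (Function.update v i b) i = A.payment succ v i := by
  unfold payment
  simp only [Function.update_idem]

theorem bidder_revenue_mem_Icc (hA : ∀ i k, 0 ≤ A.thr i k) {v : Fin n → ℝ} (hv : ∀ i, 0 ≤ v i)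
    (i : Fin n) : (if A.wins succ v i then A.payment succ v i else 0) ∈ Set.Icc 0 (v i) := by
  split_ifs with hw
  · exact A.payment_mem_Icc hA hw
  · exact ⟨le_rfl, hv i⟩

theorem Rev_mem_Icc (hs : IsStrictTotalOrder (Fin n) succ) (hA : ∀ i k, 0 ≤ A.thr i k)
    {v : Fin n → ℝ} {M : ℝ} (hM : 0 ≤ M) (hvM : ∀ i, v i ≤ M) :
    A.Rev succ v ∈ Set.Icc 0 M := by
  unfold Rev
  by_cases hex : ∃ i, A.wins succ v i
  · obtain ⟨i, hi⟩ := hex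
    rw [Finset.sum_eq_single i]
    · rw [if_pos hi]
      have := A.payment_mem_Icc hA hi
      exact ⟨this.1, this.2.trans (hvM i)⟩
    · intro j _ hj
      rw [if_neg]
      exact fun hw => hj (A.wins_unique hs hw hi)
    · exact fun h => absurd (Finset.mem_univ i) h
  · push Not at hex
    rw [Finset.sum_eq_zero fun i _ => if_neg (hex i)]
    exact ⟨le_rfl, hM⟩

end TLevel
theorem measurePreserving_update {n : ℕ} (μ : Fin n → Measure ℝ) [∀ i, IsProbabilityMeasure (μ i)]
    (i : Fin n) :
    MeasurePreserving (fun q : (Fin n → ℝ) × ℝ => Function.update q.1 i q.2)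
      ((Measure.pi μ).prod (μ i)) (Measure.pi μ) := by
  have hm : Measurable fun q : (Fin n → ℝ) × ℝ => Function.update q.1 i q.2 := by
    refine measurable_pi_lambda _ fun j => ?_
    by_cases hj : j = i
    · subst hj
      simpa using measurable_snd
    · simp only [Function.update_of_ne hj]
      exact (measurable_pi_apply j).comp measurable_fst
  refine ⟨hm, (Measure.pi_eq fun s hs => ?_).symm⟩
  rw [Measure.map_apply hm (MeasurableSet.univ_pi hs)]
  have hpre : (fun q : (Fin n → ℝ) × ℝ => Function.update q.1 i q.2) ⁻¹' Set.univ.pi s =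
      (Set.univ.pi (Function.update s i Set.univ)) ×ˢ s i := by
    ext q
    simp only [Set.mem_preimage, Set.mem_univ_pi, Set.mem_prod]
    constructor
    · intro h
      refine ⟨fun j => ?_, by simpa using h i⟩
      by_cases hj : j = i
      · subst hj
        simp
      · simpa [Function.update_of_ne hj] using h j
    · rintro ⟨h1, h2⟩ j
      by_cases hj : j = i
      · subst hj
        simpa using h2
      · simpa [Function.update_of_ne hj] using h1 j
  rw [hpre, Measure.prod_prod, Measure.pi_pi, ← Finset.prod_erase_mul _ _ (Finset.mem_univ i),
    ← Finset.prod_erase_mul (f := fun j => μ j (s j)) _ (Finset.mem_univ i)]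
  rw [Function.update_self, measure_univ, mul_one]
  congr 1
  refine Finset.prod_congr rfl fun j hj => ?_
  rw [Function.update_of_ne (Finset.ne_of_mem_erase hj)]

theorem integral_le_of_forall_update {n : ℕ} (μ : Fin n → Measure ℝ)
    [∀ i, IsProbabilityMeasure (μ i)] (i : Fin n) {g h : (Fin n → ℝ) → ℝ}
    (hg : Integrable g (Measure.pi μ)) (hh : Integrable h (Measure.pi μ))
    (hle : ∀ᵐ v ∂(Measure.pi μ),
      ∫ x, g (Function.update v i x) ∂(μ i) ≤ ∫ x, h (Function.update v i x) ∂(μ i)) :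
    ∫ v, g v ∂(Measure.pi μ) ≤ ∫ v, h v ∂(Measure.pi μ) := by
  have hmp := measurePreserving_update μ i
  have key : ∀ k : (Fin n → ℝ) → ℝ, Integrable k (Measure.pi μ) →
      Integrable (fun v => ∫ x, k (Function.update v i x) ∂(μ i)) (Measure.pi μ) ∧
      ∫ v, k v ∂(Measure.pi μ) =
        ∫ v, ∫ x, k (Function.update v i x) ∂(μ i) ∂(Measure.pi μ) := by
    intro k hk
    have hint : Integrable (fun q : (Fin n → ℝ) × ℝ => k (Function.update q.1 i q.2))
        ((Measure.pi μ).prod (μ i)) := hmp.integrable_comp_of_integrable hk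
    refine ⟨hint.integral_prod_left, ?_⟩
    rw [← integral_prod _ hint]
    conv_lhs => rw [← hmp.map_eq]
    refine integral_map hmp.measurable.aemeasurable ?_
    rw [hmp.map_eq]
    exact hk.aestronglyMeasurable
  rw [(key g hg).2, (key h hh).2]
  exact integral_mono_ae (key g hg).1 (key h hh).1 hle

theorem IsMHRDensity.integral_pay_le {n : ℕ} {μ : Measure ℝ} {f : ℝ → ℝ} (h : IsMHRDensity μ f)
    (M : SIAuction n (Set.Ici 0)) {v : Fin n → ℝ} (hv : ∀ j, 0 ≤ v j) (i : Fin n) :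
    ∫ x, M.pay (Function.update v i x) i ∂μ ≤
      ∫ x, M.alloc (Function.update v i x) i * virtualValue μ f x ∂μ := by
  have := h.prob
  have hupd : ∀ x : ℝ, 0 ≤ x → ∀ j, Function.update v i x j ∈ Set.Ici (0 : ℝ) := by
    intro x hx j
    by_cases hj : j = i
    · subst hj
      simpa using hx
    · simpa [Function.update_of_ne hj] using hv j
  have hlose : ∀ x : ℝ, 0 ≤ x → M.alloc (Function.update v i x) i = 0 →
      M.pay (Function.update v i x) i = 0 := by
    intro x hx h0
    have h1 := M.pay_le _ (hupd x hx) i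
    rw [h0, mul_zero] at h1
    exact le_antisymm h1 (M.pay_nonneg _ _)
  have hpay : ∀ x : ℝ, 0 ≤ x → M.alloc (Function.update v i x) i = 1 →
      M.pay (Function.update v i x) i ≤ x := by
    intro x hx h1
    have h2 := M.pay_le _ (hupd x hx) i
    rwa [h1, mul_one, Function.update_self] at h2
  have hdsic : ∀ x b : ℝ, 0 ≤ x → 0 ≤ b →
      x * M.alloc (Function.update v i b) i - M.pay (Function.update v i b) i ≤
        x * M.alloc (Function.update v i x) i - M.pay (Function.update v i x) i := by
    intro x b hx hb
    have h2 := M.dsic _ (hupd x hx) i b hb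
    rwa [Function.update_idem, Function.update_self] at h2
  set W : Set ℝ := {x | 0 ≤ x ∧ M.alloc (Function.update v i x) i = 1} with hW
  rcases W.eq_empty_or_nonempty with hE | hN
  · have h0 : ∀ x : ℝ, 0 ≤ x → M.alloc (Function.update v i x) i = 0 := by
      intro x hx
      rcases M.alloc01 (Function.update v i x) i with h1 | h1
      · exact h1
      · have : x ∈ W := ⟨hx, h1⟩
        rw [hE] at this
        exact absurd this (Set.notMem_empty _)
    rw [integral_eq_zero_of_ae, integral_eq_zero_of_ae]
    · filter_upwards [h.ae_nonneg] with x hx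
      rw [h0 x hx, zero_mul, Pi.zero_apply]
    · filter_upwards [h.ae_nonneg] with x hx
      exact hlose x hx (h0 x hx)
  have hbdd : BddBelow W := ⟨0, fun x hx => hx.1⟩
  have hq : 0 ≤ sInf W := le_csInf hN fun x hx => hx.1
  have hup : ∀ x, sInf W < x → x ∈ W := by
    intro x hx
    obtain ⟨y, hy, hyx⟩ := exists_lt_of_csInf_lt hN hx
    refine ⟨hq.trans hx.le, ?_⟩
    rcases M.alloc01 (Function.update v i x) i with h0 | h1
    · have h2 := hdsic x y (hq.trans hx.le) hy.1
      rw [h0, hy.2, hlose x (hq.trans hx.le) h0] at h2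
      linarith [hpay y hy.1 hy.2]
    · exact h1
  have hle : ∀ x ∈ W, M.pay (Function.update v i x) i ≤ sInf W := by
    intro x hx
    refine le_csInf hN fun y hy => ?_
    have h2 := hdsic x y hx.1 hy.1
    rw [hx.2, hy.2] at h2
    linarith [hpay y hy.1 hy.2]
  have hne : ∀ᵐ x ∂μ, x ≠ sInf W := by
    rw [ae_iff]
    simpa using h.atomless _
  have hae : ∀ᵐ x ∂μ, (sInf W ≤ x → x ∈ W) ∧ (x < sInf W → 0 ≤ x → x ∉ W) := by
    filter_upwards [hne] with x hx
    exact ⟨fun h1 => hup x (lt_of_le_of_ne h1 hx.symm),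
      fun h1 _ h2 => absurd (csInf_le hbdd h2) (not_le.2 h1)⟩
  have hnotW : ∀ x : ℝ, 0 ≤ x → x ∉ W → M.alloc (Function.update v i x) i = 0 := by
    intro x hx hxW
    rcases M.alloc01 (Function.update v i x) i with h0 | h1
    · exact h0
    · exact absurd ⟨hx, h1⟩ hxW
  calc ∫ x, M.pay (Function.update v i x) i ∂μ
      ≤ ∫ x, (Set.Ici (sInf W)).indicator (fun _ => sInf W) x ∂μ := by
        refine integral_mono_of_nonneg (Filter.Eventually.of_forall fun x => M.pay_nonneg _ _)
          ((integrable_const _).indicator measurableSet_Ici) ?_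
        filter_upwards [hae, h.ae_nonneg] with x hx hx0
        by_cases hxq : sInf W ≤ x
        · rw [Set.indicator_of_mem (Set.mem_Ici.2 hxq)]
          exact hle x (hx.1 hxq)
        · rw [Set.indicator_of_notMem (by simpa using hxq)]
          exact (hlose x hx0 (hnotW x hx0 (hx.2 (not_le.1 hxq) hx0))).le
    _ = sInf W * μ.real (Set.Ici (sInf W)) := by
        rw [integral_indicator measurableSet_Ici, setIntegral_const, smul_eq_mul, mul_comm]
    _ ≤ ∫ x in Set.Ici (sInf W), virtualValue μ f x ∂μ := h.posted_price_le hq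
    _ = ∫ x, M.alloc (Function.update v i x) i * virtualValue μ f x ∂μ := by
        rw [← integral_indicator measurableSet_Ici]
        refine integral_congr_ae ?_
        filter_upwards [hae, h.ae_nonneg] with x hx hx0
        by_cases hxq : sInf W ≤ x
        · rw [Set.indicator_of_mem (Set.mem_Ici.2 hxq), (hx.1 hxq).2, one_mul]
        · rw [Set.indicator_of_notMem (by simpa using hxq),
            hnotW x hx0 (hx.2 (not_le.1 hxq) hx0), zero_mul]

/-- The virtual surplus: the largest nonnegative virtual value in the profile. -/
noncomputable def virtualSurplus {n : ℕ} (μ : Fin n → Measure ℝ) (f : Fin n → ℝ → ℝ)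
    (v : Fin n → ℝ) : ℝ :=
  ⨆ i, max (virtualValue (μ i) (f i) (v i)) 0

section Product

variable {n : ℕ} {μ : Fin n → Measure ℝ} {f : Fin n → ℝ → ℝ}

theorem virtualValue_le_virtualSurplus (v : Fin n → ℝ) (i : Fin n) :
    virtualValue (μ i) (f i) (v i) ≤ virtualSurplus μ f v :=
  (le_max_left _ 0).trans
    (le_ciSup (f := fun i => max (virtualValue (μ i) (f i) (v i)) 0) (Set.finite_range _).bddAbove i)

theorem virtualSurplus_nonneg (v : Fin n → ℝ) : 0 ≤ virtualSurplus μ f v :=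
  Real.iSup_nonneg fun _ => le_max_right _ _

theorem virtualSurplus_le {v : Fin n → ℝ} {c : ℝ} (hc : 0 ≤ c)
    (h : ∀ i, virtualValue (μ i) (f i) (v i) ≤ c) : virtualSurplus μ f v ≤ c :=
  Real.iSup_le (fun i => max_le (h i) hc) hc

theorem integrable_eval (hμ : ∀ i, IsMHRDensity (μ i) (f i)) (i : Fin n) :
    Integrable (fun v : Fin n → ℝ => v i) (Measure.pi μ) := by
  have := fun i => (hμ i).prob
  exact (measurePreserving_eval μ i).integrable_comp_of_integrable (hμ i).integrable_id

theorem integrable_virtualValue_eval (hμ : ∀ i, IsMHRDensity (μ i) (f i)) (i : Fin n) :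
    Integrable (fun v : Fin n → ℝ => virtualValue (μ i) (f i) (v i)) (Measure.pi μ) := by
  have := fun i => (hμ i).prob
  exact (measurePreserving_eval μ i).integrable_comp_of_integrable (hμ i).integrable_virtualValue

theorem ae_pi_nonneg (hμ : ∀ i, IsMHRDensity (μ i) (f i)) :
    ∀ᵐ v ∂(Measure.pi μ), ∀ i, 0 ≤ v i := by
  have := fun i => (hμ i).prob
  exact ae_all_iff.2 fun i => Measure.tendsto_eval_ae_ae.eventually (hμ i).ae_nonneg

theorem measurable_virtualSurplus (hμ : ∀ i, IsMHRDensity (μ i) (f i)) :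
    Measurable (virtualSurplus μ f) :=
  Measurable.iSup fun i =>
    ((hμ i).measurable_virtualValue.comp (measurable_pi_apply i)).max measurable_const

theorem integrable_virtualSurplus (hμ : ∀ i, IsMHRDensity (μ i) (f i)) :
    Integrable (virtualSurplus μ f) (Measure.pi μ) := by
  refine (integrable_finsetSum Finset.univ fun i _ => (integrable_eval hμ i)).mono'
    (measurable_virtualSurplus hμ).aestronglyMeasurable ?_
  filter_upwards [ae_pi_nonneg hμ] with v hv
  rw [Real.norm_of_nonneg (virtualSurplus_nonneg v)]
  refine virtualSurplus_le (Finset.sum_nonneg fun i _ => hv i) fun i => ?_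
  exact ((hμ i).virtualValue_le _).trans
    (Finset.single_le_sum (f := fun i => v i) (fun i _ => hv i) (Finset.mem_univ i))

/-- The revenue of a truthful auction is at most the expected virtual surplus. -/
theorem lintegral_pay_le (hμ : ∀ i, IsMHRDensity (μ i) (f i)) (M : SIAuction n (Set.Ici 0)) :
    ∫⁻ v, ∑ i, ENNReal.ofReal (M.pay v i) ∂(Measure.pi μ) ≤
      ENNReal.ofReal (∫ v, virtualSurplus μ f v ∂(Measure.pi μ)) := by
  have := fun i => (hμ i).prob
  have halloc : ∀ v i, ‖M.alloc v i‖ ≤ 1 := by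
    intro v i
    rcases M.alloc01 v i with h | h <;> simp [h]
  have hpi : ∀ i, Integrable (fun v => M.pay v i) (Measure.pi μ) := by
    intro i
    refine (integrable_eval hμ i).mono' (M.pay_meas i).aestronglyMeasurable ?_
    filter_upwards [ae_pi_nonneg hμ] with v hv
    rw [Real.norm_of_nonneg (M.pay_nonneg v i)]
    refine (M.pay_le v hv i).trans (mul_le_of_le_one_right (hv i) ?_)
    exact (le_abs_self _).trans (halloc v i)
  have hai : ∀ i, Integrable (fun v => M.alloc v i * virtualValue (μ i) (f i) (v i))
      (Measure.pi μ) := fun i =>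
    (integrable_virtualValue_eval hμ i).bdd_mul (M.alloc_meas i).aestronglyMeasurable
      (Filter.Eventually.of_forall fun v => halloc v i)
  have hbidder : ∀ i, ∫ v, M.pay v i ∂(Measure.pi μ) ≤
      ∫ v, M.alloc v i * virtualValue (μ i) (f i) (v i) ∂(Measure.pi μ) := by
    intro i
    refine integral_le_of_forall_update μ i (hpi i) (hai i) ?_
    filter_upwards [ae_pi_nonneg hμ] with v hv
    simp only [Function.update_self]
    exact (hμ i).integral_pay_le M hv i
  have h1 : ∫⁻ v, ∑ i, ENNReal.ofReal (M.pay v i) ∂(Measure.pi μ) =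
      ENNReal.ofReal (∫ v, ∑ i, M.pay v i ∂(Measure.pi μ)) := by
    rw [ofReal_integral_eq_lintegral_ofReal (integrable_finsetSum _ fun i _ => hpi i)
      (Filter.Eventually.of_forall fun v => Finset.sum_nonneg fun i _ => M.pay_nonneg v i)]
    refine lintegral_congr fun v => ?_
    rw [ENNReal.ofReal_sum_of_nonneg fun i _ => M.pay_nonneg v i]
  rw [h1]
  refine ENNReal.ofReal_le_ofReal ?_
  rw [integral_finsetSum _ fun i _ => hpi i]
  refine (Finset.sum_le_sum fun i _ => hbidder i).trans ?_
  rw [← integral_finsetSum _ fun i _ => hai i]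
  refine integral_mono (integrable_finsetSum _ fun i _ => hai i) (integrable_virtualSurplus hμ)
    fun v => ?_
  have h0 : ∀ i, 0 ≤ M.alloc v i := by
    intro i
    rcases M.alloc01 v i with h | h <;> simp [h]
  calc ∑ i, M.alloc v i * virtualValue (μ i) (f i) (v i)
      ≤ ∑ i, M.alloc v i * virtualSurplus μ f v := Finset.sum_le_sum fun i _ =>
        mul_le_mul_of_nonneg_left (virtualValue_le_virtualSurplus v i) (h0 i)
    _ = (∑ i, M.alloc v i) * virtualSurplus μ f v := by rw [Finset.sum_mul]
    _ ≤ virtualSurplus μ f v := mul_le_of_le_one_left (virtualSurplus_nonneg v) (M.feas v)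

end Product
theorem measurableSet_first_bidder_above {n : ℕ} (c : ℝ) (i : Fin n) :
    MeasurableSet {v : Fin n → ℝ | c ≤ v i ∧ ∀ j < i, v j < c} := by
  have : {v : Fin n → ℝ | c ≤ v i ∧ ∀ j < i, v j < c} =
      {v | c ≤ v i} ∩ ⋂ j, ⋂ (_ : j < i), {v | v j < c} := by
    ext v
    simp
  rw [this]
  exact (measurableSet_le measurable_const (measurable_pi_apply i)).inter
    (MeasurableSet.iInter fun j => MeasurableSet.iInter fun _ =>
      measurableSet_lt (measurable_pi_apply j) measurable_const)

/-- The anonymous posted-price auction: the first bidder whose value is at least `c` buys at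
price `c`. -/
noncomputable def postedPriceAuction (n : ℕ) {c : ℝ} (hc : 0 ≤ c) : SIAuction n (Set.Ici 0) where
  alloc v i := if c ≤ v i ∧ ∀ j < i, v j < c then 1 else 0
  pay v i := if c ≤ v i ∧ ∀ j < i, v j < c then c else 0
  alloc_meas i :=
    Measurable.ite (measurableSet_first_bidder_above c i) measurable_const measurable_const
  pay_meas i :=
    Measurable.ite (measurableSet_first_bidder_above c i) measurable_const measurable_const
  alloc01 v i := by
    split_ifs
    · exact Or.inr rfl
    · exact Or.inl rfl
  feas v := by
    rw [Finset.sum_boole]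
    have : (Finset.univ.filter fun i => c ≤ v i ∧ ∀ j < i, v j < c).card ≤ 1 := by
      refine Finset.card_le_one.2 fun a ha b hb => ?_
      simp only [Finset.mem_filter, Finset.mem_univ, true_and] at ha hb
      rcases lt_trichotomy a b with h | h | h
      · exact absurd ha.1 (not_le.2 (hb.2 a h))
      · exact h
      · exact absurd hb.1 (not_le.2 (ha.2 b h))
    exact_mod_cast this
  pay_nonneg v i := by
    split_ifs
    · exact hc
    · exact le_rfl
  pay_le v _ i := by
    split_ifs with h
    · simpa using h.1
    · simp
  dsic v _ i b _ := by
    have hiff : (∀ j < i, Function.update v i b j < c) ↔ ∀ j < i, v j < c :=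
      forall_congr' fun j => forall_congr' fun hj => by rw [Function.update_of_ne hj.ne]
    simp only [Function.update_self, hiff]
    split_ifs with h1 h2 h2
    · exact le_rfl
    · have : v i < c := by
        by_contra! hle
        exact h2 ⟨hle, h1.2⟩
      linarith
    · linarith [h2.1]
    · exact le_rfl

section Product

variable {n : ℕ} {μ : Fin n → Measure ℝ} {f : Fin n → ℝ → ℝ}

theorem OPT_le_virtualSurplus (hμ : ∀ i, IsMHRDensity (μ i) (f i)) :
    OPT n (Set.Ici 0) (Measure.pi μ) ≤
      ENNReal.ofReal (∫ v, virtualSurplus μ f v ∂(Measure.pi μ)) :=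
  iSup_le fun M => lintegral_pay_le hμ M

theorem posted_price_le_virtualSurplus (hμ : ∀ i, IsMHRDensity (μ i) (f i)) [NeZero n] {c : ℝ}
    (hc : 0 ≤ c) :
    ENNReal.ofReal c * Measure.pi μ {v | c ≤ ⨆ i, v i} ≤
      ENNReal.ofReal (∫ v, virtualSurplus μ f v ∂(Measure.pi μ)) := by
  refine le_trans ?_ (lintegral_pay_le hμ (postedPriceAuction n hc))
  rw [← lintegral_indicator_const
    (measurableSet_le measurable_const (Measurable.iSup fun i => measurable_pi_apply i))]
  refine lintegral_mono fun v => ?_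
  by_cases hv : c ≤ ⨆ i, v i
  swap
  · rw [Set.indicator_of_notMem (by simpa using hv)]
    exact bot_le
  rw [Set.indicator_of_mem (by simpa using hv)]
  obtain ⟨i₀, hi₀⟩ := exists_eq_ciSup_of_finite (f := v)
  have hne : (Finset.univ.filter fun i => c ≤ v i).Nonempty :=
    ⟨i₀, by simpa [hi₀] using hv⟩
  obtain ⟨i, hi, hmin⟩ := Finset.exists_minimal hne
  simp only [Finset.mem_filter, Finset.mem_univ, true_and] at hi hmin
  have hwin : c ≤ v i ∧ ∀ j < i, v j < c := by
    refine ⟨hi, fun j hj => ?_⟩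
    by_contra! hle
    exact absurd (hmin hle hj.le) (not_le.2 hj)
  refine le_trans (le_of_eq ?_) (Finset.single_le_sum
    (f := fun i => ENNReal.ofReal ((postedPriceAuction n hc).pay v i))
    (fun i _ => (zero_le : 0 ≤ ENNReal.ofReal ((postedPriceAuction n hc).pay v i)))
    (Finset.mem_univ i))
  simp only [postedPriceAuction]
  rw [if_pos hwin]

/-- If the thresholds are virtual value thresholds then the expected revenue is at least the
expected virtual value of the winner. -/
theorem TLevel.le_integral_Rev {t : ℕ} (hμ : ∀ i, IsMHRDensity (μ i) (f i)) (A : TLevel n t)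
    (succ : Fin n → Fin n → Prop) {g : Fin t → ℝ} (hg : ∀ k, 0 ≤ g k)
    (hA : ∀ i k, A.thr i k = virtualThreshold (μ i) (f i) (g k)) :
    Integrable (A.Rev succ) (Measure.pi μ) ∧
    Integrable (fun v => ∑ i, if A.wins succ v i then virtualValue (μ i) (f i) (v i) else 0)
      (Measure.pi μ) ∧
    ∫ v, ∑ i, (if A.wins succ v i then virtualValue (μ i) (f i) (v i) else 0) ∂(Measure.pi μ) ≤
      ∫ v, A.Rev succ v ∂(Measure.pi μ) := by
  have := fun i => (hμ i).prob
  have hA0 : ∀ i k, 0 ≤ A.thr i k := fun i k => by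
    rw [hA]
    exact (hμ i).virtualThreshold_nonneg (hg k)
  have hri : ∀ i, Integrable (fun v => if A.wins succ v i then A.payment succ v i else 0)
      (Measure.pi μ) := by
    intro i
    refine (integrable_eval hμ i).mono' (A.measurable_bidder_revenue succ i).aestronglyMeasurable ?_
    filter_upwards [ae_pi_nonneg hμ] with v hv
    have := A.bidder_revenue_mem_Icc (succ := succ) hA0 hv i
    rw [Real.norm_of_nonneg this.1]
    exact this.2
  have hvi : ∀ i, Integrable
      (fun v => if A.wins succ v i then virtualValue (μ i) (f i) (v i) else 0)
      (Measure.pi μ) := fun i =>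
    (integrable_virtualValue_eval hμ i).indicator (A.measurableSet_wins succ i)
  refine ⟨integrable_finsetSum _ fun i _ => hri i, integrable_finsetSum _ fun i _ => hvi i, ?_⟩
  unfold TLevel.Rev
  rw [integral_finsetSum _ fun i _ => hvi i, integral_finsetSum _ fun i _ => hri i]
  refine Finset.sum_le_sum fun i _ => ?_
  refine integral_le_of_forall_update μ i (hvi i) (hri i)
    (Filter.Eventually.of_forall fun v => ?_)
  simp only [Function.update_self, A.payment_update]
  rcases A.winning_bids succ v i with hE | ⟨k, hk⟩
  · have h0 : ∀ x, ¬ A.wins succ (Function.update v i x) i := fun x hx => by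
      have : x ∈ {b : ℝ | A.wins succ (Function.update v i b) i} := hx
      rw [hE] at this
      exact this
    simp [h0]
  · have hw : ∀ x, A.wins succ (Function.update v i x) i ↔ x ∈ Set.Ici (A.thr i k) := fun x => by
      rw [← hk]
      rfl
    have hpay : A.payment succ v i = A.thr i k := by
      unfold TLevel.payment
      rw [hk, csInf_Ici]
    simp only [hw, hpay]
    have h1 : ∫ x, (if x ∈ Set.Ici (A.thr i k) then virtualValue (μ i) (f i) x else 0) ∂(μ i) =
        ∫ x in Set.Ici (A.thr i k), virtualValue (μ i) (f i) x ∂(μ i) := by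
      rw [← integral_indicator measurableSet_Ici]
      rfl
    have h2 : ∫ x, (if x ∈ Set.Ici (A.thr i k) then A.thr i k else 0) ∂(μ i) =
        A.thr i k * (μ i).real (Set.Ici (A.thr i k)) := by
      rw [mul_comm, ← smul_eq_mul, ← setIntegral_const, ← integral_indicator measurableSet_Ici]
      rfl
    rw [h1, h2, hA]
    exact (hμ i).le_posted_price (hg k)

end Product

/-- The virtual value grid `β ((1 + ε)^k - 1)`. -/
def geometricGrid (β ε : ℝ) (k : ℕ) : ℝ := β * ((1 + ε) ^ k - 1)

theorem geometricGrid_succ (β ε : ℝ) (k : ℕ) :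
    geometricGrid β ε (k + 1) = (1 + ε) * geometricGrid β ε k + ε * β := by
  simp only [geometricGrid, pow_succ]
  ring

theorem geometricGrid_mono {β ε : ℝ} (hβ : 0 ≤ β) (hε : 0 ≤ ε) : Monotone (geometricGrid β ε) := by
  intro k l hkl
  have := pow_le_pow_right₀ (by linarith : 1 ≤ 1 + ε) hkl
  exact mul_le_mul_of_nonneg_left (by linarith) hβ

theorem geometricGrid_nonneg {β ε : ℝ} (hβ : 0 ≤ β) (hε : 0 ≤ ε) (k : ℕ) :
    0 ≤ geometricGrid β ε k :=
  mul_nonneg hβ (sub_nonneg.2 (one_le_pow₀ (by linarith)))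

section Discretization

variable {n t : ℕ} {μ : Fin n → Measure ℝ} {f : Fin n → ℝ → ℝ} {β ε T : ℝ}

/-- Outside the tail event, the virtual value of the winner of a level auction on the geometric
virtual value grid is close to the virtual surplus. -/
theorem TLevel.virtualSurplus_le_winner (hμ : ∀ i, IsMHRDensity (μ i) (f i)) (A : TLevel n t)
    {succ : Fin n → Fin n → Prop} (hs : IsStrictTotalOrder (Fin n) succ) (hβ : 0 ≤ β) (hε : 0 ≤ ε)
    (hε1 : ε ≤ 1) (ht : 0 < t) (hT : 0 ≤ T) (hgT : T ≤ geometricGrid β ε (t - 1))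
    {v : Fin n → ℝ} {m : ℝ} (hvm : ∀ i, v i ≤ m) (hm : 0 ≤ m)
    (hv : ∀ i (k : Fin t), A.thr i k ≤ v i ↔ geometricGrid β ε k ≤ virtualValue (μ i) (f i) (v i)) :
    (1 - ε) * virtualSurplus μ f v - ε * β - (if T ≤ m then m else 0) ≤
      ∑ i, if A.wins succ v i then virtualValue (μ i) (f i) (v i) else 0 := by
  have hm0 : (0 : ℝ) ≤ if T ≤ m then m else 0 := by
    split_ifs
    · exact hm
    · exact le_rfl
  have hεβ : 0 ≤ ε * β := mul_nonneg hε hβ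
  have hlev : ∀ i (k : Fin t), ((k : ℕ) : ℤ) ≤ A.level i (v i) ↔
      geometricGrid β ε k ≤ virtualValue (μ i) (f i) (v i) := fun i k => by
    rw [A.le_level_iff, hv]
  have hwin : ∀ i, A.wins succ v i → 0 ≤ virtualValue (μ i) (f i) (v i) := by
    intro i hi
    have h := (hlev i ⟨0, ht⟩).1 (by simpa using hi.1)
    exact (geometricGrid_nonneg hβ hε _).trans h
  have hterm : ∀ i, 0 ≤ if A.wins succ v i then virtualValue (μ i) (f i) (v i) else 0 := by
    intro i
    split_ifs with h
    · exact hwin i h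
    · exact le_rfl
  by_cases hex : ∃ i, 0 ≤ A.level i (v i)
  · obtain ⟨i, hi⟩ := hex
    obtain ⟨w, hw, hmax⟩ := A.exists_wins hs hi
    refine le_trans ?_ (Finset.single_le_sum (fun i _ => hterm i) (Finset.mem_univ w))
    rw [if_pos hw]
    obtain ⟨k, hk⟩ := Int.eq_ofNat_of_zero_le hw.1
    have hkt : k < t := by
      have := A.level_lt w (v w)
      omega
    have hkw : geometricGrid β ε k ≤ virtualValue (μ w) (f w) (v w) :=
      (hlev w ⟨k, hkt⟩).1 (by simp [hk])
    by_cases hlast : k + 1 < t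
    · have hsur : virtualSurplus μ f v ≤ geometricGrid β ε (k + 1) := by
        refine virtualSurplus_le (geometricGrid_nonneg hβ hε _) fun j => ?_
        by_contra! hlt
        have h1 := (hlev j ⟨k + 1, hlast⟩).2 hlt.le
        have h2 := hmax j
        simp only [Nat.cast_add, Nat.cast_one] at h1
        omega
      rw [geometricGrid_succ] at hsur
      have hg := geometricGrid_nonneg hβ hε k
      nlinarith [mul_le_mul_of_nonneg_left hsur (sub_nonneg.2 hε1), mul_nonneg hε hεβ,
        mul_nonneg (mul_nonneg hε hε) hg]
    · have hkt' : t - 1 = k := by omega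
      rw [hkt'] at hgT
      have hTm : T ≤ m := (hgT.trans hkw).trans (((hμ w).virtualValue_le _).trans (hvm w))
      rw [if_pos hTm]
      have hsur : virtualSurplus μ f v ≤ m :=
        virtualSurplus_le hm fun j => ((hμ j).virtualValue_le _).trans (hvm j)
      nlinarith [hwin w hw, mul_nonneg hε (virtualSurplus_nonneg (μ := μ) (f := f) v)]
  · push Not at hex
    have hsur : virtualSurplus μ f v ≤ 0 := by
      refine virtualSurplus_le le_rfl fun j => ?_
      by_contra! hlt
      have h0 : geometricGrid β ε 0 = 0 := by simp [geometricGrid]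
      have h1 := (hlev j ⟨0, ht⟩).2 (by simpa [h0] using hlt.le)
      have h2 := hex j
      simp only [Nat.cast_zero] at h1
      omega
    have hsur0 : virtualSurplus μ f v = 0 := le_antisymm hsur (virtualSurplus_nonneg v)
    rw [hsur0]
    have := Finset.sum_nonneg fun i (_ : i ∈ Finset.univ) => hterm i
    linarith

/-- The level auction on the geometric virtual value grid loses, after truncation at `T`, at most
an `ε` fraction of the virtual surplus, plus `ε β`, plus twice the tail of the largest value. -/
theorem exists_TLevel_truncated_revenue [NeZero n] (hμ : ∀ i, IsMHRDensity (μ i) (f i))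
    {succ : Fin n → Fin n → Prop} (hs : IsStrictTotalOrder (Fin n) succ) (hβ : 0 ≤ β) (hε : 0 ≤ ε)
    (hε1 : ε ≤ 1) (ht : 0 < t) (hT : 0 ≤ T) (hgT : T ≤ geometricGrid β ε (t - 1)) {K : ℝ}
    (hK0 : 0 ≤ K)
    (hK : ∫⁻ v in {v | T ≤ ⨆ i, v i}, ENNReal.ofReal (⨆ i, v i) ∂(Measure.pi μ) ≤
      ENNReal.ofReal K) :
    ∃ A : TLevel n t,
      ENNReal.ofReal
        ((1 - ε) * ∫ v, virtualSurplus μ f v ∂(Measure.pi μ) - ε * β - 2 * K) ≤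
      ∫⁻ v, ENNReal.ofReal (min (A.Rev succ v) T) ∂(Measure.pi μ) := by
  have := fun i => (hμ i).prob
  have hg0 := geometricGrid_nonneg hβ hε
  let A : TLevel n t :=
    { thr := fun i k => virtualThreshold (μ i) (f i) (geometricGrid β ε k)
      mono := fun i k l hkl =>
        (hμ i).virtualThreshold_mono (hg0 k) (geometricGrid_mono hβ hε hkl) }
  have hA0 : ∀ i k, 0 ≤ A.thr i k := fun i k => (hμ i).virtualThreshold_nonneg (hg0 k)
  obtain ⟨hRi, hVi, hle⟩ := A.le_integral_Rev hμ succ (fun k => hg0 k) (fun _ _ => rfl)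
  refine ⟨A, ?_⟩
  set P := Measure.pi μ with hP
  set tail : (Fin n → ℝ) → ℝ := fun v => if T ≤ ⨆ i, v i then ⨆ i, v i else 0 with htail
  have hmeas : Measurable fun v : Fin n → ℝ => ⨆ i, v i :=
    Measurable.iSup fun i => measurable_pi_apply i
  have hTm : MeasurableSet {v : Fin n → ℝ | T ≤ ⨆ i, v i} := measurableSet_le measurable_const hmeas
  have htm : Measurable tail := Measurable.ite hTm hmeas measurable_const
  have hvle : ∀ (v : Fin n → ℝ) i, v i ≤ ⨆ i, v i := fun v i =>
    le_ciSup (Set.finite_range v).bddAbove i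
  have ht0 : ∀ v : Fin n → ℝ, 0 ≤ tail v := by
    intro v
    simp only [htail]
    split_ifs with h
    · exact hT.trans h
    · exact le_rfl
  have htl : ∫⁻ v, ENNReal.ofReal (tail v) ∂P ≤ ENNReal.ofReal K := by
    refine le_trans (le_of_eq ?_) hK
    rw [← lintegral_indicator hTm]
    refine lintegral_congr fun v => ?_
    simp only [htail, Set.indicator, Set.mem_ofPred_eq]
    split_ifs <;> simp
  have hti : Integrable tail P := by
    refine ⟨htm.aestronglyMeasurable, ?_⟩
    rw [hasFiniteIntegral_iff_ofReal (Filter.Eventually.of_forall ht0)]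
    exact htl.trans_lt ENNReal.ofReal_lt_top
  have htK : ∫ v, tail v ∂P ≤ K := by
    rw [integral_eq_lintegral_of_nonneg_ae (Filter.Eventually.of_forall ht0) hti.aestronglyMeasurable]
    exact ENNReal.toReal_le_of_le_ofReal hK0 htl
  have hmin0 : ∀ᵐ v ∂P, 0 ≤ min (A.Rev succ v) T ∧ A.Rev succ v - tail v ≤ min (A.Rev succ v) T := by
    filter_upwards [ae_pi_nonneg hμ] with v hv
    have hR := A.Rev_mem_Icc hs hA0 ((hv 0).trans (hvle v 0)) (hvle v)
    refine ⟨le_min hR.1 hT, ?_⟩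
    simp only [htail]
    split_ifs with h
    · exact (sub_nonpos.2 hR.2).trans (le_min hR.1 hT)
    · rw [sub_zero]
      exact le_min le_rfl (hR.2.trans (not_le.1 h).le)
  have hmini : Integrable (fun v => min (A.Rev succ v) T) P := hRi.inf (integrable_const T)
  rw [← ofReal_integral_eq_lintegral_ofReal hmini (hmin0.mono fun v hv => hv.1)]
  refine ENNReal.ofReal_le_ofReal ?_
  have h1 : ∫ v, A.Rev succ v ∂P - ∫ v, tail v ∂P ≤ ∫ v, min (A.Rev succ v) T ∂P := by
    rw [← integral_sub hRi hti]
    exact integral_mono_ae (hRi.sub hti) hmini (hmin0.mono fun v hv => hv.2)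
  have hSi := integrable_virtualSurplus hμ
  have h2 : (1 - ε) * ∫ v, virtualSurplus μ f v ∂P - ε * β - ∫ v, tail v ∂P ≤
      ∫ v, ∑ i, (if A.wins succ v i then virtualValue (μ i) (f i) (v i) else 0) ∂P := by
    have hint : Integrable (fun v => (1 - ε) * virtualSurplus μ f v - ε * β) P :=
      (hSi.const_mul _).sub (integrable_const _)
    have heq : (1 - ε) * ∫ v, virtualSurplus μ f v ∂P - ε * β - ∫ v, tail v ∂P =
        ∫ v, ((1 - ε) * virtualSurplus μ f v - ε * β - tail v) ∂P := by
      rw [integral_sub hint hti, integral_sub (hSi.const_mul _) (integrable_const _),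
        integral_const_mul, integral_const]
      simp [hP]
    rw [heq]
    refine integral_mono_ae (hint.sub hti) hVi ?_
    have hthr : ∀ᵐ v ∂P, ∀ i (k : Fin t), A.thr i k ≤ v i ↔
        geometricGrid β ε k ≤ virtualValue (μ i) (f i) (v i) :=
      ae_all_iff.2 fun i => ae_all_iff.2 fun k =>
        Measure.tendsto_eval_ae_ae.eventually ((hμ i).ae_threshold_le_iff (hg0 k))
    filter_upwards [ae_pi_nonneg hμ, hthr] with v hv hvt
    exact A.virtualSurplus_le_winner hμ hs hβ hε hε1 ht hT hgT (hvle v)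
      ((hv 0).trans (hvle v 0)) hvt
  linarith

end Discretization

theorem ne_top_of_tail_lintegral {n : ℕ} [NeZero n] (P : Measure (Fin n → ℝ)) [IsProbabilityMeasure P]
    {T K : ℝ} (hK : ∫⁻ v in {v | T ≤ ⨆ i, v i}, ENNReal.ofReal (⨆ i, v i) ∂P ≤ ENNReal.ofReal K)
    (i : Fin n) : ∫⁻ v, ENNReal.ofReal (v i) ∂P ≠ ⊤ := by
  have hmeas : Measurable fun v : Fin n → ℝ => ⨆ i, v i :=
    Measurable.iSup fun i => measurable_pi_apply i
  have hTm : MeasurableSet {v : Fin n → ℝ | T ≤ ⨆ i, v i} := measurableSet_le measurable_const hmeas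
  refine ne_top_of_le_ne_top (b := ENNReal.ofReal K + ENNReal.ofReal T) (by simp) ?_
  refine (lintegral_mono fun v =>
    ENNReal.ofReal_le_ofReal (le_ciSup (Set.finite_range v).bddAbove i)).trans ?_
  rw [← lintegral_add_compl _ hTm]
  refine add_le_add hK ?_
  calc ∫⁻ v in {v | T ≤ ⨆ i, v i}ᶜ, ENNReal.ofReal (⨆ i, v i) ∂P
      ≤ ∫⁻ v in {v | T ≤ ⨆ i, v i}ᶜ, ENNReal.ofReal T ∂P := by
        refine setLIntegral_mono' hTm.compl fun v hv => ENNReal.ofReal_le_ofReal ?_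
        simp only [Set.mem_compl_iff, Set.mem_ofPred_eq, not_le] at hv
        exact hv.le
    _ ≤ ENNReal.ofReal T := by
        rw [setLIntegral_const]
        exact mul_le_of_le_one_right' prob_le_one

theorem le_geometricGrid_of_le {β ε : ℝ} (hβ : 0 < β) (hε : 0 < ε) (hε1 : ε < 1 / 3) {t : ℕ}
    (ht : 3 * (1 / ε + Real.log (Real.log (1 / ε)) / Real.log (1 + ε)) ≤ t)
    (hL : 1 ≤ Real.log (1 / ε)) :
    0 < t ∧ 2 * β * Real.log (1 / ε) ≤ geometricGrid β ε (t - 1) := by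
  set L := Real.log (1 / ε) with hLdef
  have hlog : 0 < Real.log (1 + ε) := Real.log_pos (by linarith)
  have hlogL : 0 ≤ Real.log L := Real.log_nonneg hL
  have htpos : 0 < t := by
    have : (0 : ℝ) < t := lt_of_lt_of_le (by positivity) ht
    exact_mod_cast this
  refine ⟨htpos, ?_⟩
  have hlow : 3 / 4 * ε ≤ Real.log (1 + ε) := by
    have h := Real.one_sub_inv_le_log_of_pos (by linarith : 0 < 1 + ε)
    refine le_trans ?_ h
    have : 1 - (1 + ε)⁻¹ = ε / (1 + ε) := by
      field_simp
      ring
    rw [this, le_div_iff₀ (by linarith)]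
    nlinarith
  have hup : Real.log (1 + ε) ≤ 1 / 3 := by
    have := Real.log_le_sub_one_of_pos (by linarith : 0 < 1 + ε)
    linarith
  have hlog3 : Real.log 3 ≤ 3 / 2 := by
    have h := Real.log_le_sub_one_of_pos (by norm_num : (0 : ℝ) < 3 / 2)
    have h2 := Real.log_two_lt_d9
    have : Real.log 3 = Real.log (3 / 2) + Real.log 2 := by
      rw [← Real.log_mul (by norm_num) (by norm_num)]
      norm_num
    linarith
  have hmul : 9 / 4 + 3 * Real.log L ≤ t * Real.log (1 + ε) := by
    have h1 := mul_le_mul_of_nonneg_right ht hlog.le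
    have h2 : 3 * (1 / ε + Real.log L / Real.log (1 + ε)) * Real.log (1 + ε) =
        3 * (Real.log (1 + ε) / ε) + 3 * Real.log L := by
      field_simp
    have h3 : 3 / 4 ≤ Real.log (1 + ε) / ε := by
      rw [le_div_iff₀ hε]
      exact hlow
    linarith
  have hpow : Real.log (3 * L) ≤ Real.log ((1 + ε) ^ (t - 1)) := by
    rw [Real.log_pow, Real.log_mul (by norm_num) (by linarith), Nat.cast_sub htpos, Nat.cast_one]
    linarith
  have hpow' := (Real.log_le_log_iff (by linarith) (by positivity)).1 hpow
  unfold geometricGrid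
  nlinarith

/-- Representation error of truncated `t`-level auctions for MHR bidders: there are
universal constants `c₁, c₂ > 0` such that for independent MHR bidders and every
anchoring point `β̂` satisfying the stated probability and tail bounds, for every
`t ≥ c₂ (1/ε' + ln ln(1/ε') / ln(1+ε'))` there is a `t`-level auction whose
`(2β̂ ln(1/ε'))`-truncated expected revenue is at least `(1 - c₁ ε' ln(1/ε'))` times
the optimal revenue. -/
theorem representation_error_tlevel_mhr :
    ∃ c₁ c₂ : ℝ, 0 < c₁ ∧ 0 < c₂ ∧
      ∀ n : ℕ, 1 ≤ n →
      ∀ (Fi : Fin n → Measure ℝ) (f : Fin n → ℝ → ℝ),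
        (∀ i, IsProbabilityMeasure (Fi i)) →
        (∀ i, ∀ x : ℝ, Fi i {x} = 0) →
        (∀ i, Measurable (f i)) →
        (∀ i x, 0 ≤ f i x) →
        (∀ i, Fi i = MeasureTheory.volume.withDensity fun x => ENNReal.ofReal (f i x)) →
        (∀ i, Fi i (Set.Iio 0) = 0) →
        (∀ i, ∀ x y : ℝ, x ≤ y → (Fi i (Set.Iic y)).toReal < 1 →
          f i x / (1 - (Fi i (Set.Iic x)).toReal) ≤
            f i y / (1 - (Fi i (Set.Iic y)).toReal)) →
      ∀ ε' : ℝ, ε' ∈ Set.Ioo (0 : ℝ) (1 / 2) →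
      ∀ succ : Fin n → Fin n → Prop, IsStrictTotalOrder (Fin n) succ →
      ∀ βhat : ℝ, 0 < βhat →
        ENNReal.ofReal (1 - 1 / Real.sqrt (Real.exp 1) - ε') ≤
          Measure.pi Fi {v | βhat / 2 ≤ ⨆ i, v i} →
        (∫⁻ v in {v | 2 * βhat * Real.log (1 / ε') ≤ ⨆ i, v i},
            ENNReal.ofReal (⨆ i, v i) ∂(Measure.pi Fi)) ≤
          ENNReal.ofReal (36 * βhat * ε' * Real.log (1 / ε')) →
      ∀ t : ℕ,
        c₂ * (1 / ε' + Real.log (Real.log (1 / ε')) / Real.log (1 + ε')) ≤ t →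
      ∃ A : TLevel n t,
        ENNReal.ofReal (1 - c₁ * ε' * Real.log (1 / ε')) *
            OPT n (Set.Ici 0) (Measure.pi Fi) ≤
          ∫⁻ v, ENNReal.ofReal
              (min (A.Rev succ v) (2 * βhat * Real.log (1 / ε'))) ∂(Measure.pi Fi) := by
  refine ⟨600, 3, by norm_num, by norm_num, ?_⟩
  intro n hn Fi f hprob hatom hfm hf0 hdens hIio hmhr ε hε succ hs β hβ hβP hK t ht
  obtain ⟨hε0, hε2⟩ := hε
  have : NeZero n := ⟨by omega⟩
  set L := Real.log (1 / ε) with hL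
  have hL2 : 69 / 100 ≤ L := by
    have h1 : Real.log 2 ≤ L := by
      refine Real.log_le_log (by norm_num) ?_
      rw [le_div_iff₀ hε0]
      linarith
    linarith [Real.log_two_gt_d9]
  by_cases hbig : 1 ≤ 600 * ε * L
  · refine ⟨⟨fun _ _ => 0, fun _ _ _ _ => le_rfl⟩, ?_⟩
    rw [ENNReal.ofReal_eq_zero.2 (by linarith), zero_mul]
    exact bot_le
  rw [not_le] at hbig
  have hε3 : ε < 1 / 400 := by nlinarith
  have hL1 : 1 ≤ L := by
    rw [hL, Real.le_log_iff_exp_le (by positivity)]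
    have h1 : 400 < 1 / ε := by
      rw [lt_div_iff₀ hε0]
      linarith
    linarith [Real.exp_one_lt_d9]
  have hK0 : 0 ≤ 36 * β * ε * L := by positivity
  have hμ : ∀ i, IsMHRDensity (Fi i) (f i) := fun i =>
    { prob := hprob i
      atomless := hatom i
      measurable := hfm i
      nonneg := hf0 i
      eq_withDensity := hdens i
      Iio_zero := hIio i
      hazard_mono := hmhr i
      mean_ne_top := by
        have h := ne_top_of_tail_lintegral _ hK i
        rwa [(measurePreserving_eval Fi i).lintegral_comp
          (f := fun x => ENNReal.ofReal x) (by fun_prop)] at h }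
  obtain ⟨htpos, hgrid⟩ := le_geometricGrid_of_le hβ hε0 (by linarith) ht hL1
  obtain ⟨A, hA⟩ := exists_TLevel_truncated_revenue hμ hs hβ.le hε0.le (by linarith) htpos
    (by positivity) hgrid hK0 hK
  refine ⟨A, le_trans ?_ hA⟩
  set W := ∫ v, virtualSurplus Fi f v ∂(Measure.pi Fi) with hW
  have hW0 : 0 ≤ W := integral_nonneg virtualSurplus_nonneg
  have hWβ : β / 8 ≤ W := by
    have hsqrt : 1 / Real.sqrt (Real.exp 1) ≤ 61 / 100 := by
      have h1 : (164 / 100 : ℝ) ≤ Real.sqrt (Real.exp 1) := by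
        refine Real.le_sqrt_of_sq_le ?_
        linarith [Real.exp_one_gt_d9]
      rw [div_le_iff₀ (by linarith)]
      linarith
    have h1 : ENNReal.ofReal (1 / 4) ≤ Measure.pi Fi {v | β / 2 ≤ ⨆ i, v i} :=
      (ENNReal.ofReal_le_ofReal (by linarith)).trans hβP
    have h2 := posted_price_le_virtualSurplus hμ (by positivity : 0 ≤ β / 2)
    have h3 := (mul_le_mul_right h1 (ENNReal.ofReal (β / 2))).trans h2
    rw [← ENNReal.ofReal_mul (by positivity), ENNReal.ofReal_le_ofReal_iff hW0] at h3
    linarith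
  refine (mul_le_mul_right (OPT_le_virtualSurplus hμ) _).trans ?_
  rw [← ENNReal.ofReal_mul (by linarith)]
  refine ENNReal.ofReal_le_ofReal ?_
  have h1 : ε * β ≤ 8 * (ε * W) := by nlinarith
  have h2 : ε * L * β ≤ 8 * (ε * L * W) := by
    nlinarith [mul_le_mul_of_nonneg_left hWβ (by positivity : 0 ≤ ε * L)]
  have h3 : ε * W ≤ ε * L * W := by
    nlinarith [mul_le_mul_of_nonneg_left hL1 (by positivity : 0 ≤ ε * W)]
  have h4 : 0 ≤ ε * W := by positivity
  nlinarith
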